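/- arXiv:0911.4210 — 7 statements merged into one kernel-verified Lean document; each statement's English description precedes it below -/
import Mathlib

section
/- Suppose E is self dual with respect to a non-degenerate hermitian form ⟨·,·⟩_E, and F is any left A-module equipped with a hermitian form ⟨·,·⟩_F. Then every A-linear map S : E → F is adjointable: there exists an A-linear map S* : F → E such that ⟨Sζ, η⟩_F = ⟨ζ, S*η⟩_E for all ζ ∈ E and η ∈ F. -/
/-- A form that is linear in the first variable, with values in a ring, sends `0` to `0` there. -/
theorem form_zero_left {A M : Type*} [Ring A] [AddCommGroup M] [Module A M] {B : M → M → A}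
    (hB : ∀ (a : A) (x y z : M), B (a • x + y) z = a * B x z + B y z) (z : M) :
    B 0 z = 0 := by
  simpa using hB 1 0 0 z

/-- A hermitian form is conjugate-linear in the second variable. -/
theorem form_smul_add_right {A M : Type*} [Ring A] [StarRing A] [AddCommGroup M] [Module A M]
    {B : M → M → A} (hB : ∀ (a : A) (x y z : M), B (a • x + y) z = a * B x z + B y z)
    (hstar : ∀ x y : M, star (B x y) = B y x) (a : A) (x y z : M) :
    B z (a • x + y) = B z x * star a + B z y := by
  rw [← hstar, hB, star_add, star_mul, hstar, hstar]

theorem form_add_right {A M : Type*} [Ring A] [StarRing A] [AddCommGroup M] [Module A M]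
    {B : M → M → A} (hB : ∀ (a : A) (x y z : M), B (a • x + y) z = a * B x z + B y z)
    (hstar : ∀ x y : M, star (B x y) = B y x) (x y z : M) :
    B z (x + y) = B z x + B z y := by
  simpa using form_smul_add_right hB hstar 1 x y z

theorem form_smul_right {A M : Type*} [Ring A] [StarRing A] [AddCommGroup M] [Module A M]
    {B : M → M → A} (hB : ∀ (a : A) (x y z : M), B (a • x + y) z = a * B x z + B y z)
    (hstar : ∀ x y : M, star (B x y) = B y x) (a : A) (x z : M) :
    B z (a • x) = B z x * star a := by
  have h0 : B z 0 = 0 := by rw [← hstar, form_zero_left hB, star_zero]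
  simpa [h0] using form_smul_add_right hB hstar a x 0 z

/-- A non-degenerate hermitian form separates points in the second variable. -/
theorem form_ext_right {A M : Type*} [Ring A] [StarRing A] [AddCommGroup M] [Module A M]
    {B : M → M → A} (hB : ∀ (a : A) (x y z : M), B (a • x + y) z = a * B x z + B y z)
    (hstar : ∀ x y : M, star (B x y) = B y x) (hnd : ∀ x : M, B x x = 0 → x = 0)
    {u v : M} (h : ∀ z : M, B z u = B z v) : u = v := by
  refine sub_eq_zero.1 (hnd _ ?_)
  have hadd := form_add_right hB hstar (u - v) v (u - v)
  rw [sub_add_cancel, h] at hadd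
  exact right_eq_add.1 hadd


/- STATEMENT 3: If E is self dual w.r.t. a non-degenerate hermitian form, and F is any left
A-module with a hermitian form, then every A-linear map S : E → F is adjointable. -/

theorem statement3
    {A E F : Type*} [Ring A] [Algebra ℂ A] [StarRing A] [StarModule ℂ A]
    [AddCommGroup E] [Module A E] [AddCommGroup F] [Module A F]
    (B : E → E → A)
    (hB1 : ∀ (a : A) (x y z : E), B (a • x + y) z = a * B x z + B y z)
    (hB2 : ∀ x y : E, star (B x y) = B y x)
    (hBnd : ∀ x : E, B x x = 0 → x = 0)
    (hBsd : ∀ ω : E →ₗ[A] A, ∃ η : E, ∀ ζ : E, ω ζ = B ζ η)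
    (C : F → F → A)
    (hC1 : ∀ (a : A) (x y z : F), C (a • x + y) z = a * C x z + C y z)
    (hC2 : ∀ x y : F, star (C x y) = C y x)
    (S : E →ₗ[A] F) :
    ∃ S' : F →ₗ[A] E, ∀ (ζ : E) (η : F), C (S ζ) η = B ζ (S' η) := by
  let ω (η : F) : E →ₗ[A] A :=
    { toFun := fun ζ => C (S ζ) η
      map_add' := fun x y => by simpa using hC1 1 (S x) (S y) η
      map_smul' := fun a x => by
        simpa [form_zero_left hC1] using hC1 a (S x) 0 η }
  choose T hT using fun η => hBsd (ω η)
  replace hT (η : F) (ζ : E) : C (S ζ) η = B ζ (T η) := hT η ζ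
  refine ⟨{ toFun := T, map_add' := fun x y => ?_, map_smul' := fun a x => ?_ },
    fun ζ η => hT η ζ⟩ <;> refine form_ext_right hB1 hB2 hBnd fun z => ?_
  · rw [← hT, form_add_right hC1 hC2, form_add_right hB1 hB2, hT, hT]
  · rw [← hT, form_smul_right hC1 hC2, RingHom.id_apply, form_smul_right hB1 hB2, hT]
end

section
/- A finitely generated left A-module E with a non-degenerate hermitian form ⟨·,·⟩_A has dual module frames (i.e. there exist d and ζ₁,…,ζ_d, ζ̃₁,…,ζ̃_d ∈ E with Σᵢ ⟨ζ,ζᵢ⟩_A ζ̃ᵢ = Σᵢ ⟨ζ,ζ̃ᵢ⟩_A ζᵢ = ζ for every ζ ∈ E) if and only if E is a projective A-module and E is self dual. -/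
/- STATEMENT 4: A finitely generated left A-module E with a non-degenerate hermitian form has
dual module frames iff E is projective and self dual. -/

theorem statement4
    {A E : Type*} [Ring A] [Algebra ℂ A] [StarRing A] [StarModule ℂ A]
    [AddCommGroup E] [Module A E] [Module.Finite A E]
    (B : E → E → A)
    (hB1 : ∀ (a : A) (x y z : E), B (a • x + y) z = a * B x z + B y z)
    (hB2 : ∀ x y : E, star (B x y) = B y x)
    (hBnd : ∀ x : E, B x x = 0 → x = 0) :
    (∃ (d : ℕ) (ζs ζt : Fin d → E),
        ∀ x : E, (∑ i, B x (ζs i) • ζt i = x) ∧ (∑ i, B x (ζt i) • ζs i = x))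
      ↔ (Module.Projective A E ∧ ∀ ω : E →ₗ[A] A, ∃ η : E, ∀ ζ : E, ω ζ = B ζ η) := by
  have add_left (x y z : E) : B (x + y) z = B x z + B y z := by
    simpa using hB1 1 x y z
  have zero_left (z : E) : B 0 z = 0 := by simpa using add_left 0 0 z
  have smul_left (a : A) (x z : E) : B (a • x) z = a * B x z := by
    simpa [zero_left] using hB1 a x 0 z
  let L (z : E) : E →ₗ[A] A :=
    { toFun := fun x => B x z
      map_add' := fun x y => add_left x y z
      map_smul' := fun a x => smul_left a x z }
  have sum_left {d : ℕ} (a : Fin d → A) (v : Fin d → E) (z : E) :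
      B (∑ i, a i • v i) z = ∑ i, a i * B (v i) z := by
    change L z _ = _
    simp [L]
  have sum_right {d : ℕ} (a : Fin d → A) (v : Fin d → E) (z : E) :
      B z (∑ i, a i • v i) = ∑ i, B z (v i) * star (a i) := by
    rw [← hB2, sum_left, star_sum]
    simp only [star_mul, hB2]
  constructor
  · rintro ⟨d, ζs, ζt, h⟩
    constructor
    · refine Module.Projective.of_split (LinearMap.pi fun i => L (ζs i))
        (Fintype.linearCombination A ζt) ?_
      ext x
      exact (h x).1
    · intro ω
      refine ⟨∑ i, star (ω (ζt i)) • ζs i, fun x => ?_⟩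
      rw [sum_right]
      conv_lhs => rw [← (h x).1]
      simp
  · rintro ⟨_, hdual⟩
    obtain ⟨d, f, hf⟩ := Module.Finite.exists_fin' A E
    obtain ⟨g, hg⟩ := Module.projective_lifting_property f LinearMap.id hf
    choose η hη using fun i => hdual (LinearMap.proj i ∘ₗ g)
    have expand (x : E) : ∑ i, B x (η i) • f (Pi.single i 1) = x := by
      have hx : f (g x) = x := LinearMap.congr_fun hg x
      conv_rhs => rw [← hx, pi_eq_sum_univ' (g x), map_sum]
      refine Finset.sum_congr rfl fun i _ => ?_
      rw [← hη i x, map_smul]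
      congr 2
    refine ⟨d, η, fun i => f (Pi.single i 1), fun x => ⟨expand x, ?_⟩⟩
    have pairing (z : E) : B z (∑ i, B x (f (Pi.single i 1)) • η i) = B z x := by
      rw [sum_right]
      conv_rhs => rw [← expand z, sum_left]
      simp only [hB2]
    refine sub_eq_zero.mp (hBnd _ ?_)
    rw [← hB2, sub_eq_add_neg, add_left, ← neg_one_smul A x, smul_left, star_add, star_mul,
      hB2, hB2, pairing]
    simp
end

section
/- For every η ∈ Λ and every ζ ∈ H, the family (⟨ζ, ν_g η⟩)_{g∈G} belongs to ℓ²(G) and Σ_{g∈G} |⟨ζ, ν_g η⟩|² ≤ ‖ζ‖² · ‖T_{⟨η,η⟩_A}‖. Consequently, if (ζ_n) is a sequence in H converging to ζ in norm, then (⟨ζ_n, ν_g η⟩)_{g∈G} converges to (⟨ζ, ν_g η⟩)_{g∈G} in ℓ²(G). -/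
/- STATEMENT 6: For every η ∈ Λ and every ζ ∈ H, (⟨ζ, ν_g η⟩)_{g∈G} ∈ ℓ²(G) with
Σ_g |⟨ζ, ν_g η⟩|² ≤ ‖ζ‖² ‖T_{⟨η,η⟩_A}‖; consequently ζ_n → ζ in H implies
(⟨ζ_n, ν_g η⟩)_g → (⟨ζ, ν_g η⟩)_g in ℓ²(G). -/

open scoped ComplexConjugate ENNReal
open Filter

noncomputable section

/-- The inner product with the paper's convention: linear in the first variable,
conjugate-linear in the second. -/
def ipp {H : Type*} [NormedAddCommGroup H] [InnerProductSpace ℂ H] (x y : H) : ℂ :=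
  @inner ℂ _ _ y x

abbrev l2 (G : Type*) : Type _ := lp (fun _ : G => ℂ) 2

/-- The left translation operator `λ_f` on `ℓ²(G)`: `(λ_f x)(g) = x (f⁻¹ g)`. -/
def lamCLM {G : Type*} [Group G] (f : G) : l2 G →L[ℂ] l2 G :=
  LinearMap.mkContinuous
    { toFun := fun x => ⟨fun g => x (f⁻¹ * g), by
        have hs : Summable fun g : G => ‖x g‖ ^ (2 : ℝ≥0∞).toReal :=
          (lp.memℓp x).summable (by norm_num)
        exact memℓp_gen (hs.comp_injective (mul_right_injective f⁻¹))⟩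
      map_add' := fun x y => rfl
      map_smul' := fun c x => rfl } 1
    (fun x => by
      have h2 : (0:ℝ) < (2 : ℝ≥0∞).toReal := by norm_num
      rw [one_mul]
      apply le_of_eq
      rw [lp.norm_eq_tsum_rpow h2, lp.norm_eq_tsum_rpow h2]
      congr 1
      exact ((Equiv.mulLeft f⁻¹).tsum_eq fun g => ‖x g‖ ^ (2:ℝ≥0∞).toReal))

/-- The operator `T_a = Σ_f a(f) λ_f` on `ℓ²(G)`, for `a : G → ℂ` finitely supported;
`(T_a x)(g) = Σ_f a(f) x(f⁻¹ g)`. -/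
def Tconv {G : Type*} [Group G] (a : G → ℂ) : l2 G →L[ℂ] l2 G := ∑ᶠ f, a f • lamCLM f

open scoped InnerProductSpace in
theorem inner_single_Tconv_single {G : Type*} [Group G] [DecidableEq G] {a : G → ℂ}
    (ha : (Function.support a).Finite) (u v : G) (z w : ℂ) :
    ⟪(lp.single 2 u z : l2 G), Tconv a (lp.single 2 v w : l2 G)⟫_ℂ
      = conj z * w * a (u * v⁻¹) := by
  have hs : (Function.support fun f => a f • lamCLM f) ⊆ ha.toFinset := by
    intro f hf
    have : a f ≠ 0 := fun h => hf (by simp [h])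
    simpa using this
  have hlam : ∀ f : G, (lamCLM f (lp.single 2 v w : l2 G)) u
      = if f = u * v⁻¹ then w else 0 := by
    intro f
    change (lp.single 2 v w : l2 G) (f⁻¹ * u) = _
    rw [lp.single_apply, Pi.single_apply]
    have : f⁻¹ * u = v ↔ f = u * v⁻¹ := by
      rw [inv_mul_eq_iff_eq_mul, eq_mul_inv_iff_mul_eq, eq_comm]
    simp [this]
  rw [lp.inner_single_left, Tconv, finsum_eq_sum_of_support_subset _ hs]
  simp only [sum_apply, smul_apply, lp.coeFn_sum,
    Finset.sum_apply, lp.coeFn_smul, Pi.smul_apply, hlam, smul_eq_mul, mul_ite, mul_zero,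
    Finset.sum_ite_eq', RCLike.inner_apply]
  split_ifs with h
  · ring
  · have : a (u * v⁻¹) = 0 := by simpa using h
    simp [this]

open scoped InnerProductSpace in
theorem norm_sum_smul_orbit_sq_le {G H : Type*} [Group G]
    [NormedAddCommGroup H] [InnerProductSpace ℂ H] (ν : G →* (H ≃ₗᵢ[ℂ] H)) (η : H)
    (hη : {g : G | ipp η (ν g η) ≠ 0}.Finite) (S : Finset G) (c : G → ℂ) :
    ‖∑ g ∈ S, c g • ν g⁻¹ η‖ ^ 2
      ≤ ‖Tconv (fun g => ipp η (ν g η))‖ * ∑ g ∈ S, ‖c g‖ ^ 2 := by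
  classical
  set T := Tconv (fun g => ipp η (ν g η)) with hT
  set x : l2 G := ∑ g ∈ S, lp.single 2 g (conj (c g)) with hx
  have hxn : ‖x‖ ^ 2 = ∑ g ∈ S, ‖c g‖ ^ 2 := by
    have := lp.norm_sum_single (E := fun _ : G => ℂ) (p := 2) (by norm_num)
      (fun g => conj (c g)) S
    simpa [← hx] using this
  have horbit : ∀ u v : G, ⟪ν u⁻¹ η, ν v⁻¹ η⟫_ℂ = ipp η (ν (v * u⁻¹) η) := by
    intro u v
    rw [ipp, ← (ν v).inner_map_map (ν u⁻¹ η), map_mul, map_inv ν v]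
    simp
  have hinner : ⟪∑ g ∈ S, c g • ν g⁻¹ η, ∑ g ∈ S, c g • ν g⁻¹ η⟫_ℂ = ⟪x, T x⟫_ℂ := by
    rw [hx, map_sum]
    simp only [sum_inner, inner_sum]
    rw [Finset.sum_comm]
    refine Finset.sum_congr rfl fun u _ => Finset.sum_congr rfl fun v _ => ?_
    rw [hT, inner_single_Tconv_single hη, inner_smul_left, inner_smul_right, horbit]
    simp only [RingHomCompTriple.comp_apply, RingHom.id_apply]
    ring
  calc ‖∑ g ∈ S, c g • ν g⁻¹ η‖ ^ 2
      = ‖⟪∑ g ∈ S, c g • ν g⁻¹ η, ∑ g ∈ S, c g • ν g⁻¹ η⟫_ℂ‖ := by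
        rw [inner_self_eq_norm_sq_to_K]; simp
    _ = ‖⟪x, T x⟫_ℂ‖ := by rw [hinner]
    _ ≤ ‖x‖ * (‖T‖ * ‖x‖) :=
        (norm_inner_le_norm _ _).trans (by gcongr; exact T.le_opNorm x)
    _ = ‖T‖ * ∑ g ∈ S, ‖c g‖ ^ 2 := by rw [← hxn]; ring

/-- Bessel's inequality for a family of vectors with a bounded Gram form. -/
theorem sum_norm_inner_sq_le_of_bound {ι H : Type*} [NormedAddCommGroup H]
    [InnerProductSpace ℂ H] {w : ι → H} {C : ℝ} (hC : 0 ≤ C) (S : Finset ι)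
    (hw : ∀ c : ι → ℂ, ‖∑ i ∈ S, c i • w i‖ ^ 2 ≤ C * ∑ i ∈ S, ‖c i‖ ^ 2) (ζ : H) :
    ∑ i ∈ S, ‖ipp ζ (w i)‖ ^ 2 ≤ ‖ζ‖ ^ 2 * C := by
  set s := ∑ i ∈ S, ‖ipp ζ (w i)‖ ^ 2 with hs
  set y := ∑ i ∈ S, ipp ζ (w i) • w i
  have hs0 : 0 ≤ s := by positivity
  have hy : (inner ℂ y ζ : ℂ) = s := by
    simp only [y, hs, sum_inner, inner_smul_left, Complex.ofReal_sum]
    refine Finset.sum_congr rfl fun i _ => ?_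
    change conj (ipp ζ (w i)) * ipp ζ (w i) = _
    rw [Complex.conj_mul']
    norm_cast
  have hle : s ≤ ‖y‖ * ‖ζ‖ := by
    have := norm_inner_le_norm (𝕜 := ℂ) y ζ
    rwa [hy, Complex.norm_real, Real.norm_of_nonneg hs0] at this
  have hsq : s * s ≤ (‖ζ‖ ^ 2 * C) * s :=
    calc s * s ≤ (‖y‖ * ‖ζ‖) * (‖y‖ * ‖ζ‖) := by gcongr
      _ = ‖ζ‖ ^ 2 * ‖y‖ ^ 2 := by ring
      _ ≤ ‖ζ‖ ^ 2 * (C * s) := by gcongr; exact hw _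
      _ = _ := by ring
  rcases hs0.eq_or_lt with h | h
  · rw [← h]; positivity
  · exact le_of_mul_le_mul_right hsq h

theorem summable_and_tsum_norm_ipp_orbit_sq_le {G H : Type*} [Group G]
    [NormedAddCommGroup H] [InnerProductSpace ℂ H] (ν : G →* (H ≃ₗᵢ[ℂ] H)) (η : H)
    (hη : {g : G | ipp η (ν g η) ≠ 0}.Finite) (ζ : H) :
    (Summable fun g : G => ‖ipp ζ (ν g η)‖ ^ 2) ∧
      ∑' g : G, ‖ipp ζ (ν g η)‖ ^ 2
        ≤ ‖ζ‖ ^ 2 * ‖Tconv (fun g => ipp η (ν g η))‖ := by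
  have hb : ∀ S : Finset G, ∑ g ∈ S, ‖ipp ζ (ν g⁻¹ η)‖ ^ 2
      ≤ ‖ζ‖ ^ 2 * ‖Tconv (fun g => ipp η (ν g η))‖ := fun S =>
    sum_norm_inner_sq_le_of_bound (norm_nonneg _) S
      (norm_sum_smul_orbit_sq_le ν η hη S) ζ
  have hsum : Summable fun g : G => ‖ipp ζ (ν g⁻¹ η)‖ ^ 2 :=
    summable_of_sum_le (fun _ => by positivity) hb
  refine ⟨(Equiv.inv G).summable_iff.mp hsum, ?_⟩
  rw [← (Equiv.inv G).tsum_eq]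
  exact hsum.tsum_le_of_sum_le hb

theorem statement6
    {G H : Type*} [Group G] [Countable G]
    [NormedAddCommGroup H] [InnerProductSpace ℂ H] [CompleteSpace H]
    (ν : G →* (H ≃ₗᵢ[ℂ] H))
    (Λ : Submodule ℂ H)
    (hΛinv : ∀ g : G, ∀ ζ ∈ Λ, ν g ζ ∈ Λ)
    (hΛfin : ∀ ζ ∈ Λ, ∀ η ∈ Λ, {g : G | ipp ζ (ν g η) ≠ 0}.Finite)
    (η : H) (hη : η ∈ Λ) :
    (∀ ζ : H,
        Memℓp (fun g : G => ipp ζ (ν g η)) 2 ∧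
        ∑' g : G, ‖ipp ζ (ν g η)‖ ^ 2
          ≤ ‖ζ‖ ^ 2 * ‖Tconv (fun g => ipp η (ν g η))‖) ∧
    (∀ (ζs : ℕ → H) (ζ : H), Tendsto ζs atTop (nhds ζ) →
        Tendsto (fun n => ∑' g : G, ‖ipp (ζs n) (ν g η) - ipp ζ (ν g η)‖ ^ 2)
          atTop (nhds 0)) := by
  have key := summable_and_tsum_norm_ipp_orbit_sq_le ν η (hΛfin η hη η hη)
  refine ⟨fun ζ => ⟨memℓp_gen (by simpa using (key ζ).1), (key ζ).2⟩, fun ζs ζ hζ => ?_⟩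
  have hsub : ∀ n (g : G), ipp (ζs n) (ν g η) - ipp ζ (ν g η) = ipp (ζs n - ζ) (ν g η) :=
    fun n g => (inner_sub_right _ _ _).symm
  simp only [hsub]
  refine squeeze_zero (fun n => tsum_nonneg fun g => by positivity)
    (fun n => (key (ζs n - ζ)).2) ?_
  simpa using ((tendsto_iff_norm_sub_tendsto_zero.mp hζ).pow 2).mul_const
    ‖Tconv (fun g => ipp η (ν g η))‖

end
end

section
/- Let E ⊆ Λ be an A-submodule and let ζ₁,…,ζ_d, ζ̃₁,…,ζ̃_d ∈ E. If the families {ν_g ζᵢ}_{g∈G, 1≤i≤d} and {ν_g ζ̃ᵢ}_{g∈G, 1≤i≤d} form dual G-frames for the closure of E in H, then ζ₁,…,ζ_d and ζ̃₁,…,ζ̃_d form dual module frames for E, i.e. Σ_{i=1}^d π₀(⟨ζ, ζᵢ⟩_A) ζ̃ᵢ = Σ_{i=1}^d π₀(⟨ζ, ζ̃ᵢ⟩_A) ζᵢ = ζ for every ζ ∈ E. -/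
/- STATEMENT 7: If {ν_g ζᵢ} and {ν_g ζ̃ᵢ} form dual G-frames for the closure of an A-submodule
E ⊆ Λ, then ζ₁,…,ζ_d and ζ̃₁,…,ζ̃_d form dual module frames for E. -/

open scoped ComplexConjugate

noncomputable section

/-- `ζ₁,…,ζ_d` form a `G`-frame for `K`. -/
def IsGFrame {G H : Type*} [Group G] [NormedAddCommGroup H] [InnerProductSpace ℂ H]
    (ν : G →* (H ≃ₗᵢ[ℂ] H)) {d : ℕ} (ζs : Fin d → H) (K : Set H) : Prop :=
  (∀ (g : G) (i : Fin d), (ν g (ζs i) : H) ∈ K) ∧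
  ∃ A B : ℝ, 0 < A ∧ 0 < B ∧ ∀ ζ ∈ K,
    A * ‖ζ‖ ^ 2 ≤ (∑' g : G, ∑ i, ‖ipp ζ (ν g (ζs i))‖ ^ 2) ∧
    (∑' g : G, ∑ i, ‖ipp ζ (ν g (ζs i))‖ ^ 2) ≤ B * ‖ζ‖ ^ 2

/-- `ζ₁,…,ζ_d` and `ζ̃₁,…,ζ̃_d` form dual `G`-frames for `K`. -/
def DualGFrames {G H : Type*} [Group G] [NormedAddCommGroup H] [InnerProductSpace ℂ H]
    (ν : G →* (H ≃ₗᵢ[ℂ] H)) {d : ℕ} (ζs ζt : Fin d → H) (K : Set H) : Prop :=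
  IsGFrame ν ζs K ∧ IsGFrame ν ζt K ∧
  ∀ ζ ∈ K,
    HasSum (fun p : G × Fin d => ipp ζ (ν p.1 (ζs p.2)) • (ν p.1 (ζt p.2) : H)) ζ ∧
    HasSum (fun p : G × Fin d => ipp ζ (ν p.1 (ζt p.2)) • (ν p.1 (ζs p.2) : H)) ζ

/-- A sum over `α × ι` with `ι` finite, each of whose slices in `α` has finite support, is the
finite sum of the slice sums. -/
theorem sum_finsum_eq_of_hasSum {α ι M : Type*} [Fintype ι] [AddCommMonoid M] [TopologicalSpace M]
    [T3Space M] [ContinuousAdd M] {f : α × ι → M} {a : M} (hf : HasSum f a)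
    (hfin : ∀ i, (Function.support fun x => f (x, i)).Finite) :
    ∑ i, ∑ᶠ x, f (x, i) = a := by
  have hswap : HasSum (fun p : ι × α => f (p.2, p.1)) a :=
    (Equiv.prodComm ι α).hasSum_iff.mpr hf
  refine (hasSum_fintype _).unique (hswap.prod_fiberwise fun i => ?_)
  rw [← tsum_eq_finsum (L := .unconditional α) (hfin i)]
  exact (summable_of_hasFiniteSupport (hfin i)).hasSum

theorem statement7
    {G H : Type*} [Group G] [Countable G]
    [NormedAddCommGroup H] [InnerProductSpace ℂ H] [CompleteSpace H]
    (ν : G →* (H ≃ₗᵢ[ℂ] H))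
    (Λ : Submodule ℂ H)
    (hΛinv : ∀ g : G, ∀ ζ ∈ Λ, ν g ζ ∈ Λ)
    (hΛfin : ∀ ζ ∈ Λ, ∀ η ∈ Λ, {g : G | ipp ζ (ν g η) ≠ 0}.Finite)
    (E : Submodule ℂ H) (hEΛ : E ≤ Λ)
    (hEinv : ∀ g : G, ∀ ζ ∈ E, ν g ζ ∈ E)
    {d : ℕ} (ζs ζt : Fin d → H)
    (hζs : ∀ i, ζs i ∈ E) (hζt : ∀ i, ζt i ∈ E)
    (hdual : DualGFrames ν ζs ζt (closure (E : Set H))) :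
    ∀ ζ ∈ E,
      (∑ i, ∑ᶠ g : G, ipp ζ (ν g (ζs i)) • (ν g (ζt i) : H)) = ζ ∧
      (∑ i, ∑ᶠ g : G, ipp ζ (ν g (ζt i)) • (ν g (ζs i) : H)) = ζ := by
  intro ζ hζ
  obtain ⟨h₁, h₂⟩ := hdual.2.2 ζ (subset_closure hζ)
  have hfin (η ξ : H) (hη : η ∈ E) :
      (Function.support fun g : G => ipp ζ (ν g η) • (ν g ξ : H)).Finite :=
    (hΛfin ζ (hEΛ hζ) η (hEΛ hη)).subset (Function.support_smul_subset_left _ _)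
  exact ⟨sum_finsum_eq_of_hasSum h₁ fun i => hfin (ζs i) (ζt i) (hζs i),
    sum_finsum_eq_of_hasSum h₂ fun i => hfin (ζt i) (ζs i) (hζt i)⟩

end
end

section
/- Let E ⊆ Λ be an A-submodule and suppose ζ₁,…,ζ_d, ζ̃₁,…,ζ̃_d ∈ E form dual module frames for E. Then, writing Ē for the closure of E in H: (i) for all ζ, η ∈ Ē one has ⟨ζ, η⟩ = Σ_{g∈G} Σ_{i=1}^d ⟨ζ, ν_g ζᵢ⟩ ⟨ν_g ζ̃ᵢ, η⟩; (ii) for every ζ ∈ Ē, (Σ_{i=1}^d ‖T_{⟨ζ̃ᵢ,ζ̃ᵢ⟩_A}‖)⁻¹ ‖ζ‖² ≤ Σ_{g∈G} Σ_{i=1}^d |⟨ζ, ν_g ζᵢ⟩|² ≤ (Σ_{i=1}^d ‖T_{⟨ζᵢ,ζᵢ⟩_A}‖) ‖ζ‖²; consequently {ν_g ζᵢ} and {ν_g ζ̃ᵢ} form dual G-frames for Ē. -/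
/- STATEMENT 8: If ζ₁,…,ζ_d and ζ̃₁,…,ζ̃_d form dual module frames for an A-submodule E ⊆ Λ,
then (i) the reproducing formula holds on Ē, (ii) the explicit frame bounds hold on Ē, and
consequently {ν_g ζᵢ} and {ν_g ζ̃ᵢ} form dual G-frames for Ē. -/

open scoped ComplexConjugate ENNReal

noncomputable section

section BesselFamilies

variable {ι H : Type*} [NormedAddCommGroup H] [InnerProductSpace ℂ H]

lemma norm_ipp_comm (x y : H) : ‖ipp x y‖ = ‖ipp y x‖ :=
  norm_inner_symm y x

/-- `u` is a Bessel family with bound `M`. -/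
def IsBesselFamily (u : ι → H) (M : ℝ) : Prop :=
  ∀ (F : Finset ι) (ζ : H), ∑ p ∈ F, ‖ipp ζ (u p)‖ ^ 2 ≤ M * ‖ζ‖ ^ 2

lemma IsBesselFamily.of_norm_sum_sq_le {u : ι → H} {M : ℝ} (hM : 0 ≤ M)
    (h : ∀ (F : Finset ι) (c : ι → ℂ), ‖∑ p ∈ F, c p • u p‖ ^ 2 ≤ M * ∑ p ∈ F, ‖c p‖ ^ 2) :
    IsBesselFamily u M := by
  intro F ζ
  set S := ∑ p ∈ F, ‖ipp ζ (u p)‖ ^ 2 with hS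
  have hS0 : 0 ≤ S := Finset.sum_nonneg fun _ _ => by positivity
  have hinner : (S : ℂ) = inner ℂ ζ (∑ p ∈ F, ipp ζ (u p) • u p) := by
    rw [inner_sum, hS]
    push_cast
    refine Finset.sum_congr rfl fun p _ => ?_
    rw [inner_smul_right, ipp, ← inner_conj_symm ζ (u p), Complex.mul_conj']
  have hle : S ≤ ‖ζ‖ * ‖∑ p ∈ F, ipp ζ (u p) • u p‖ := by
    have := norm_inner_le_norm (𝕜 := ℂ) ζ (∑ p ∈ F, ipp ζ (u p) • u p)
    rwa [← hinner, Complex.norm_real, Real.norm_of_nonneg hS0] at this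
  rcases hS0.eq_or_lt with h0 | hpos
  · rw [← h0]; positivity
  · refine le_of_mul_le_mul_right ?_ hpos
    calc S * S ≤ (‖ζ‖ * ‖∑ p ∈ F, ipp ζ (u p) • u p‖) *
          (‖ζ‖ * ‖∑ p ∈ F, ipp ζ (u p) • u p‖) := mul_self_le_mul_self hS0 hle
      _ = ‖ζ‖ ^ 2 * ‖∑ p ∈ F, ipp ζ (u p) • u p‖ ^ 2 := by ring
      _ ≤ ‖ζ‖ ^ 2 * (M * S) := by gcongr; exact h F _
      _ = M * ‖ζ‖ ^ 2 * S := by ring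

lemma IsBesselFamily.norm_sum_sq_le {u : ι → H} {M : ℝ} (hM : 0 ≤ M)
    (h : IsBesselFamily u M) (F : Finset ι) (c : ι → ℂ) :
    ‖∑ p ∈ F, c p • u p‖ ^ 2 ≤ M * ∑ p ∈ F, ‖c p‖ ^ 2 := by
  set v := ∑ p ∈ F, c p • u p with hv
  have hle : ‖v‖ ^ 2 ≤ ∑ p ∈ F, ‖c p‖ * ‖ipp v (u p)‖ := by
    calc ‖v‖ ^ 2 = ‖inner ℂ v v‖ := by
          rw [inner_self_eq_norm_sq_to_K]; simp
      _ = ‖∑ p ∈ F, c p * inner ℂ v (u p)‖ := by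
          conv_lhs => rw [hv, inner_sum, ← hv]
          simp only [inner_smul_right]
      _ ≤ ∑ p ∈ F, ‖c p * inner ℂ v (u p)‖ := norm_sum_le _ _
      _ = ∑ p ∈ F, ‖c p‖ * ‖ipp v (u p)‖ := by
          refine Finset.sum_congr rfl fun p _ => ?_
          rw [norm_mul, norm_ipp_comm, ipp]
  have hc : 0 ≤ ∑ p ∈ F, ‖c p‖ ^ 2 := Finset.sum_nonneg fun _ _ => by positivity
  rcases (sq_nonneg ‖v‖).eq_or_lt with h0 | hpos
  · rw [← h0]; positivity
  · refine le_of_mul_le_mul_right ?_ hpos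
    calc ‖v‖ ^ 2 * ‖v‖ ^ 2 = (‖v‖ ^ 2) ^ 2 := by ring
      _ ≤ (∑ p ∈ F, ‖c p‖ * ‖ipp v (u p)‖) ^ 2 := by gcongr
      _ ≤ (∑ p ∈ F, ‖c p‖ ^ 2) * ∑ p ∈ F, ‖ipp v (u p)‖ ^ 2 :=
          Finset.sum_mul_sq_le_sq_mul_sq _ _ _
      _ ≤ (∑ p ∈ F, ‖c p‖ ^ 2) * (M * ‖v‖ ^ 2) := by gcongr; exact h F v
      _ = M * (∑ p ∈ F, ‖c p‖ ^ 2) * ‖v‖ ^ 2 := by ring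

lemma IsBesselFamily.summable {u : ι → H} {M : ℝ} (h : IsBesselFamily u M) (ζ : H) :
    Summable fun p => ‖ipp ζ (u p)‖ ^ 2 :=
  summable_of_sum_le (fun _ => by positivity) fun F => h F ζ

lemma IsBesselFamily.tsum_le {u : ι → H} {M : ℝ} (h : IsBesselFamily u M) (ζ : H) :
    ∑' p, ‖ipp ζ (u p)‖ ^ 2 ≤ M * ‖ζ‖ ^ 2 :=
  (h.summable ζ).tsum_le_of_sum_le fun F => h F ζ

/-- The set on which a reproducing formula between two Bessel families holds is closed. -/
lemma IsBesselFamily.isClosed_hasSum {u v : ι → H} {M N : ℝ} (hN : 0 ≤ N)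
    (hu : IsBesselFamily u M) (hv : IsBesselFamily v N) :
    IsClosed {ζ : H | HasSum (fun p => ipp ζ (u p) • v p) ζ} := by
  have hlip : ∀ F : Finset ι, LipschitzWith (√(N * M)).toNNReal
      fun ζ : H => ∑ p ∈ F, ipp ζ (u p) • v p := by
    intro F
    refine LipschitzWith.of_dist_le_mul fun x y => ?_
    rw [dist_eq_norm, dist_eq_norm, ← Finset.sum_sub_distrib,
      Real.coe_toNNReal _ (Real.sqrt_nonneg _)]
    have hxy : ∑ p ∈ F, (ipp x (u p) • v p - ipp y (u p) • v p) =
        ∑ p ∈ F, ipp (x - y) (u p) • v p := by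
      simp only [ipp, inner_sub_right, sub_smul]
    rw [hxy]
    have hsq : ‖∑ p ∈ F, ipp (x - y) (u p) • v p‖ ^ 2 ≤ N * M * ‖x - y‖ ^ 2 :=
      calc _ ≤ N * ∑ p ∈ F, ‖ipp (x - y) (u p)‖ ^ 2 := hv.norm_sum_sq_le hN F _
        _ ≤ N * (M * ‖x - y‖ ^ 2) := by gcongr; exact hu F _
        _ = _ := by ring
    calc _ ≤ √(N * M * ‖x - y‖ ^ 2) := Real.le_sqrt_of_sq_le hsq
      _ = √(N * M) * ‖x - y‖ := by
        rw [Real.sqrt_mul' _ (sq_nonneg _), Real.sqrt_sq (norm_nonneg _)]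
  exact (LipschitzWith.uniformEquicontinuous _ _ hlip).equicontinuous.isClosed_setOfPred_tendsto
    continuous_id

lemma IsBesselFamily.norm_sq_le_of_hasSum {u v : ι → H} {M N : ℝ} (hN : 0 ≤ N)
    (hu : IsBesselFamily u M) (hv : IsBesselFamily v N) {ζ : H}
    (h : HasSum (fun p => ipp ζ (u p) • v p) ζ) :
    ‖ζ‖ ^ 2 ≤ N * ∑' p, ‖ipp ζ (u p)‖ ^ 2 := by
  refine le_of_tendsto (h.norm.pow 2) (Filter.Eventually.of_forall fun F => ?_)
  refine (hv.norm_sum_sq_le hN F _).trans ?_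
  gcongr
  exact (hu.summable ζ).sum_le_tsum F fun _ _ => by positivity

end BesselFamilies

section Orbits

variable {G H : Type*} [Group G] [NormedAddCommGroup H] [InnerProductSpace ℂ H]

lemma Tconv_apply {a : G → ℂ} (ha : {g | a g ≠ 0}.Finite) (x : l2 G) (k : G) :
    (Tconv a x : G → ℂ) k = ∑ f ∈ ha.toFinset, a f * x (f⁻¹ * k) := by
  have hsub : Function.support (fun f => a f • lamCLM f) ⊆ ha.toFinset := by
    intro f hf
    simp only [Set.Finite.coe_toFinset, Set.mem_ofPred_eq]
    rintro h0
    exact hf (by simp [h0])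
  rw [Tconv, finsum_eq_sum_of_support_subset _ hsub, sum_apply,
    lp.coeFn_sum, Finset.sum_apply]
  rfl

open Classical in
lemma Tconv_single_apply {a : G → ℂ} (ha : {g | a g ≠ 0}.Finite) (h k : G) (c : ℂ) :
    (Tconv a (lp.single 2 h c) : G → ℂ) k = a (k * h⁻¹) * c := by
  rw [Tconv_apply ha, Finset.sum_eq_single (k * h⁻¹)]
  · simp
  · intro f _ hf
    rw [lp.single_apply_ne, mul_zero]
    rintro rfl
    exact hf (by group)
  · intro hf
    have : a (k * h⁻¹) = 0 := by simpa using hf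
    rw [this, zero_mul]

lemma ipp_orbit (ν : G →* (H ≃ₗᵢ[ℂ] H)) (ξ : H) (g h : G) :
    ipp (ν g ξ) (ν h ξ) = ipp ξ (ν (g⁻¹ * h) ξ) := by
  have : ν h ξ = ν g (ν (g⁻¹ * h) ξ) := by
    conv_lhs => rw [← mul_inv_cancel_left g h, map_mul]
    rfl
  rw [this, ipp, ipp, LinearIsometryEquiv.inner_map_map]

open Classical in
lemma norm_sum_orbit_sq_le (ν : G →* (H ≃ₗᵢ[ℂ] H)) (ξ : H)
    (hξ : {g : G | ipp ξ (ν g ξ) ≠ 0}.Finite) (F : Finset G) (c : G → ℂ) :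
    ‖∑ k ∈ F, c k • ν k⁻¹ ξ‖ ^ 2 ≤
      ‖Tconv (fun g => ipp ξ (ν g ξ))‖ * ∑ k ∈ F, ‖c k‖ ^ 2 := by
  set T := Tconv (fun g => ipp ξ (ν g ξ)) with hT
  set x : l2 G := ∑ k ∈ F, lp.single 2 k (conj (c k)) with hx
  have hnorm : ‖x‖ ^ 2 = ∑ k ∈ F, ‖c k‖ ^ 2 := by
    have := lp.norm_sum_single (E := fun _ : G => ℂ) (p := 2) (by norm_num)
      (fun k => conj (c k)) F
    simpa using this
  have hinner : inner ℂ x (T x) =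
      inner ℂ (∑ k ∈ F, c k • ν k⁻¹ ξ) (∑ k ∈ F, c k • ν k⁻¹ ξ) := by
    conv_lhs => rw [hx, map_sum]
    simp only [sum_inner, inner_sum]
    rw [Finset.sum_comm]
    refine Finset.sum_congr rfl fun h _ => Finset.sum_congr rfl fun k _ => ?_
    have horb := ipp_orbit ν ξ h⁻¹ k⁻¹
    rw [inv_inv] at horb
    rw [lp.inner_single_left, hT, Tconv_single_apply hξ, ← horb, inner_smul_left,
      inner_smul_right, ipp]
    simp only [RCLike.inner_apply, RingHomCompTriple.comp_apply, RingHom.id_apply]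
    ring
  calc ‖∑ k ∈ F, c k • ν k⁻¹ ξ‖ ^ 2 = ‖inner ℂ x (T x)‖ := by
        rw [hinner, inner_self_eq_norm_sq_to_K]; simp
    _ ≤ ‖x‖ * ‖T x‖ := norm_inner_le_norm _ _
    _ ≤ ‖x‖ * (‖T‖ * ‖x‖) := by gcongr; exact T.le_opNorm x
    _ = ‖T‖ * ‖x‖ ^ 2 := by ring
    _ = _ := by rw [hnorm]

lemma isBesselFamily_orbit (ν : G →* (H ≃ₗᵢ[ℂ] H)) (ξ : H)
    (hξ : {g : G | ipp ξ (ν g ξ) ≠ 0}.Finite) :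
    IsBesselFamily (fun g => ν g ξ) ‖Tconv (fun g => ipp ξ (ν g ξ))‖ := by
  intro F ζ
  have h := IsBesselFamily.of_norm_sum_sq_le (norm_nonneg _) (norm_sum_orbit_sq_le ν ξ hξ)
    (F.map (Equiv.inv G).toEmbedding) ζ
  simpa only [Finset.sum_map, Equiv.coe_toEmbedding, Equiv.inv_apply, inv_inv] using h

open Classical in
lemma isBesselFamily_orbits (ν : G →* (H ≃ₗᵢ[ℂ] H)) {d : ℕ} (ξ : Fin d → H)
    (hξ : ∀ i, {g : G | ipp (ξ i) (ν g (ξ i)) ≠ 0}.Finite) :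
    IsBesselFamily (fun p : G × Fin d => ν p.1 (ξ p.2))
      (∑ i, ‖Tconv (fun g => ipp (ξ i) (ν g (ξ i)))‖) := by
  intro F ζ
  calc ∑ p ∈ F, ‖ipp ζ (ν p.1 (ξ p.2))‖ ^ 2
      ≤ ∑ p ∈ F.image Prod.fst ×ˢ Finset.univ, ‖ipp ζ (ν p.1 (ξ p.2))‖ ^ 2 := by
        refine Finset.sum_le_sum_of_subset_of_nonneg (fun p hp => ?_) fun _ _ _ => by positivity
        simpa using ⟨p.2, hp⟩
    _ = ∑ i, ∑ g ∈ F.image Prod.fst, ‖ipp ζ (ν g (ξ i))‖ ^ 2 := Finset.sum_product_right _ _ _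
    _ ≤ ∑ i, ‖Tconv (fun g => ipp (ξ i) (ν g (ξ i)))‖ * ‖ζ‖ ^ 2 :=
        Finset.sum_le_sum fun i _ => isBesselFamily_orbit ν (ξ i) (hξ i) _ ζ
    _ = _ := by rw [Finset.sum_mul]

lemma IsBesselFamily.tsum_orbits {ν : G →* (H ≃ₗᵢ[ℂ] H)} {d : ℕ} {ξ : Fin d → H} {M : ℝ}
    (h : IsBesselFamily (fun p : G × Fin d => ν p.1 (ξ p.2)) M) (ζ : H) :
    ∑' g : G, ∑ i, ‖ipp ζ (ν g (ξ i))‖ ^ 2 =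
      ∑' p : G × Fin d, ‖ipp ζ (ν p.1 (ξ p.2))‖ ^ 2 :=
  ((h.summable ζ).hasSum.prod_fiberwise fun _ => hasSum_fintype _).tsum_eq

lemma hasSum_orbits_of_sum_finsum {ν : G →* (H ≃ₗᵢ[ℂ] H)} {d : ℕ} {ξ η : Fin d → H} {ζ : H}
    (hfin : ∀ i, {g : G | ipp ζ (ν g (ξ i)) ≠ 0}.Finite)
    (h : ∑ i, ∑ᶠ g : G, ipp ζ (ν g (ξ i)) • (ν g (η i) : H) = ζ) :
    HasSum (fun p : G × Fin d => ipp ζ (ν p.1 (ξ p.2)) • (ν p.1 (η p.2) : H)) ζ := by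
  have hsupp : ∀ i, (Function.support fun g => ipp ζ (ν g (ξ i)) • (ν g (η i) : H)).Finite :=
    fun i => (hfin i).subset fun g hg h0 => hg (by simp [h0])
  have hfinite : (Function.support fun p : G × Fin d =>
      ipp ζ (ν p.1 (ξ p.2)) • (ν p.1 (η p.2) : H)).Finite := by
    refine (Set.finite_iUnion fun i => (hsupp i).image fun g => (g, i)).subset fun p hp => ?_
    exact Set.mem_iUnion.2 ⟨p.2, p.1, hp, rfl⟩
  have hsum := (summable_of_hasFiniteSupport (L := .unconditional _) hfinite).hasSum
  have hswap := ((Equiv.prodComm (Fin d) G).hasSum_iff.2 hsum).prod_fiberwise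
    fun i => (summable_of_hasFiniteSupport (L := .unconditional _) (hsupp i)).hasSum
  have heq := hswap.unique (hasSum_fintype _)
  simp only [fun i => tsum_eq_finsum (L := .unconditional G) (hsupp i), h] at heq
  rwa [heq] at hsum

lemma isGFrame_of_hasSum {ν : G →* (H ≃ₗᵢ[ℂ] H)} {d : ℕ} {ξ η : Fin d → H} {K : Set H}
    {M N : ℝ} (hM : 0 ≤ M) (hN : 0 ≤ N)
    (hξ : IsBesselFamily (fun p : G × Fin d => ν p.1 (ξ p.2)) M)
    (hη : IsBesselFamily (fun p : G × Fin d => ν p.1 (η p.2)) N)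
    (hK : ∀ g i, ν g (ξ i) ∈ K)
    (h : ∀ ζ ∈ K, HasSum (fun p : G × Fin d => ipp ζ (ν p.1 (ξ p.2)) • (ν p.1 (η p.2) : H)) ζ) :
    IsGFrame ν ξ K := by
  refine ⟨hK, (N + 1)⁻¹, M + 1, by positivity, by positivity, fun ζ hζ => ?_⟩
  rw [hξ.tsum_orbits]
  have hnonneg : 0 ≤ ∑' p : G × Fin d, ‖ipp ζ (ν p.1 (ξ p.2))‖ ^ 2 :=
    tsum_nonneg fun _ => by positivity
  constructor
  · rw [inv_mul_le_iff₀ (by positivity)]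
    have := hξ.norm_sq_le_of_hasSum hN hη (h ζ hζ)
    linarith
  · have := hξ.tsum_le ζ
    have := sq_nonneg ‖ζ‖
    linarith

end Orbits

theorem statement8
    {G H : Type*} [Group G] [Countable G]
    [NormedAddCommGroup H] [InnerProductSpace ℂ H] [CompleteSpace H]
    (ν : G →* (H ≃ₗᵢ[ℂ] H))
    (Λ : Submodule ℂ H)
    (hΛinv : ∀ g : G, ∀ ζ ∈ Λ, ν g ζ ∈ Λ)
    (hΛfin : ∀ ζ ∈ Λ, ∀ η ∈ Λ, {g : G | ipp ζ (ν g η) ≠ 0}.Finite)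
    (E : Submodule ℂ H) (hEΛ : E ≤ Λ)
    (hEinv : ∀ g : G, ∀ ζ ∈ E, ν g ζ ∈ E)
    {d : ℕ} (ζs ζt : Fin d → H)
    (hζs : ∀ i, ζs i ∈ E) (hζt : ∀ i, ζt i ∈ E)
    (hframes : ∀ ζ ∈ E,
      (∑ i, ∑ᶠ g : G, ipp ζ (ν g (ζs i)) • (ν g (ζt i) : H)) = ζ ∧
      (∑ i, ∑ᶠ g : G, ipp ζ (ν g (ζt i)) • (ν g (ζs i) : H)) = ζ) :
    (∀ ζ ∈ closure (E : Set H), ∀ η ∈ closure (E : Set H),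
        ipp ζ η = ∑' g : G, ∑ i, ipp ζ (ν g (ζs i)) * ipp (ν g (ζt i) : H) η) ∧
    (∀ ζ ∈ closure (E : Set H),
        (∑ i, ‖Tconv (fun g => ipp (ζt i) (ν g (ζt i)))‖)⁻¹ * ‖ζ‖ ^ 2
            ≤ (∑' g : G, ∑ i, ‖ipp ζ (ν g (ζs i))‖ ^ 2) ∧
        (∑' g : G, ∑ i, ‖ipp ζ (ν g (ζs i))‖ ^ 2)
            ≤ (∑ i, ‖Tconv (fun g => ipp (ζs i) (ν g (ζs i)))‖) * ‖ζ‖ ^ 2) ∧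
    DualGFrames ν ζs ζt (closure (E : Set H)) := by
  have hfin : ∀ ζ ∈ E, ∀ η ∈ E, {g : G | ipp ζ (ν g η) ≠ 0}.Finite :=
    fun ζ hζ η hη => hΛfin ζ (hEΛ hζ) η (hEΛ hη)
  have hs := isBesselFamily_orbits ν ζs fun i => hfin _ (hζs i) _ (hζs i)
  have ht := isBesselFamily_orbits ν ζt fun i => hfin _ (hζt i) _ (hζt i)
  have hs0 : 0 ≤ ∑ i, ‖Tconv (fun g => ipp (ζs i) (ν g (ζs i)))‖ :=
    Finset.sum_nonneg fun _ _ => norm_nonneg _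
  have ht0 : 0 ≤ ∑ i, ‖Tconv (fun g => ipp (ζt i) (ν g (ζt i)))‖ :=
    Finset.sum_nonneg fun _ _ => norm_nonneg _
  have hst : ∀ ζ ∈ closure (E : Set H),
      HasSum (fun p : G × Fin d => ipp ζ (ν p.1 (ζs p.2)) • (ν p.1 (ζt p.2) : H)) ζ :=
    fun ζ hζ => closure_minimal (fun ξ hξ => hasSum_orbits_of_sum_finsum
      (fun i => hfin ξ hξ _ (hζs i)) (hframes ξ hξ).1) (hs.isClosed_hasSum ht0 ht) hζ
  have hts : ∀ ζ ∈ closure (E : Set H),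
      HasSum (fun p : G × Fin d => ipp ζ (ν p.1 (ζt p.2)) • (ν p.1 (ζs p.2) : H)) ζ :=
    fun ζ hζ => closure_minimal (fun ξ hξ => hasSum_orbits_of_sum_finsum
      (fun i => hfin ξ hξ _ (hζt i)) (hframes ξ hξ).2) (ht.isClosed_hasSum hs0 hs) hζ
  refine ⟨fun ζ hζ η _ => ?_, fun ζ hζ => ⟨?_, ?_⟩, ?_, ?_, fun ζ hζ => ⟨hst ζ hζ, hts ζ hζ⟩⟩
  · have h := (innerSL ℂ η).hasSum (hst ζ hζ)
    simp only [innerSL_apply_apply, inner_smul_right] at h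
    exact (h.prod_fiberwise fun _ => hasSum_fintype _).tsum_eq.symm
  · rw [hs.tsum_orbits]
    exact inv_mul_le_of_le_mul₀ ht0 (tsum_nonneg fun _ => by positivity)
      (hs.norm_sq_le_of_hasSum ht0 ht (hst ζ hζ))
  · rw [hs.tsum_orbits]
    exact hs.tsum_le ζ
  · exact isGFrame_of_hasSum hs0 ht0 hs ht
      (fun g i => subset_closure (hEinv g _ (hζs i))) hst
  · exact isGFrame_of_hasSum ht0 hs0 ht hs
      (fun g i => subset_closure (hEinv g _ (hζt i))) hts

end
end

section
/- Let E ⊆ Λ be an A-submodule and let ζ₁,…,ζ_d, ζ̃₁,…,ζ̃_d ∈ E. The following are equivalent: (1) the families {ν_g ζᵢ}_{g∈G, 1≤i≤d} and {ν_g ζ̃ᵢ}_{g∈G, 1≤i≤d} form bi-orthogonal dual G-frames for the closure of E in H; (2) ζ₁,…,ζ_d and ζ̃₁,…,ζ̃_d form dual module bases for E, i.e. they are dual module frames and ⟨ζᵢ, ν_g ζ̃ⱼ⟩ = δ_{g,e} δ_{i,j} for all g ∈ G and all i, j. -/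
/- STATEMENT 9: {ν_g ζᵢ} and {ν_g ζ̃ᵢ} form bi-orthogonal dual G-frames for the closure of E
iff ζ₁,…,ζ_d and ζ̃₁,…,ζ̃_d form dual module bases for E. -/

open scoped ComplexConjugate

noncomputable section

/-- Schur test: if the Gram matrix of `v` has row sums bounded by `C`, then finite synthesis
is bounded. -/
theorem norm_sq_sum_smul_le_of_gram {ι H : Type*} [NormedAddCommGroup H]
    [InnerProductSpace ℂ H] {v : ι → H} {C : ℝ}
    (hC : ∀ i (S : Finset ι), ∑ j ∈ S, ‖ipp (v i) (v j)‖ ≤ C) (S : Finset ι) (c : ι → ℂ) :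
    ‖∑ i ∈ S, c i • v i‖ ^ 2 ≤ C * ∑ i ∈ S, ‖c i‖ ^ 2 := by
  have hsymm : ∀ i j, ‖ipp (v i) (v j)‖ = ‖ipp (v j) (v i)‖ := fun i j => norm_inner_symm _ _
  have hrow : ∑ i ∈ S, ∑ j ∈ S, ‖c i‖ ^ 2 * ‖ipp (v i) (v j)‖ ≤ C * ∑ i ∈ S, ‖c i‖ ^ 2 := by
    rw [Finset.mul_sum]
    refine Finset.sum_le_sum fun i _ => ?_
    rw [← Finset.mul_sum, mul_comm]
    exact mul_le_mul_of_nonneg_right (hC i S) (by positivity)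
  have hcol : ∑ i ∈ S, ∑ j ∈ S, ‖c j‖ ^ 2 * ‖ipp (v i) (v j)‖ ≤ C * ∑ i ∈ S, ‖c i‖ ^ 2 := by
    rw [Finset.sum_comm]
    simpa only [hsymm] using hrow
  have hexp : ‖∑ i ∈ S, c i • v i‖ ^ 2
      ≤ ∑ i ∈ S, ∑ j ∈ S, ‖c i‖ * ‖c j‖ * ‖ipp (v i) (v j)‖ := by
    rw [sq, ← inner_self_eq_norm_mul_norm (𝕜 := ℂ), sum_inner]
    refine (RCLike.re_le_norm _).trans ((norm_sum_le _ _).trans ?_)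
    refine Finset.sum_le_sum fun i _ => ?_
    rw [inner_sum]
    refine (norm_sum_le _ _).trans (Finset.sum_le_sum fun j _ => ?_)
    rw [inner_smul_left, inner_smul_right, norm_mul, norm_mul, RCLike.norm_conj, mul_assoc,
      hsymm i j, ipp]
  have hamgm : ∑ i ∈ S, ∑ j ∈ S, ‖c i‖ * ‖c j‖ * ‖ipp (v i) (v j)‖
      ≤ ∑ i ∈ S, ∑ j ∈ S,
        (‖c i‖ ^ 2 * ‖ipp (v i) (v j)‖ + ‖c j‖ ^ 2 * ‖ipp (v i) (v j)‖) / 2 := by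
    refine Finset.sum_le_sum fun i _ => Finset.sum_le_sum fun j _ => ?_
    nlinarith [mul_nonneg (sq_nonneg (‖c i‖ - ‖c j‖)) (norm_nonneg (ipp (v i) (v j)))]
  simp only [← Finset.sum_div, Finset.sum_add_distrib] at hamgm
  linarith

/-- The Bessel inequality for a family whose Gram matrix has bounded row sums. -/
theorem sum_norm_sq_ipp_le_of_gram {ι H : Type*} [NormedAddCommGroup H]
    [InnerProductSpace ℂ H] {v : ι → H} {C : ℝ}
    (hC0 : 0 ≤ C) (hC : ∀ i (S : Finset ι), ∑ j ∈ S, ‖ipp (v i) (v j)‖ ≤ C)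
    (S : Finset ι) (x : H) :
    ∑ i ∈ S, ‖ipp x (v i)‖ ^ 2 ≤ C * ‖x‖ ^ 2 := by
  set T := ∑ i ∈ S, ‖ipp x (v i)‖ ^ 2 with hT
  have hsyn := norm_sq_sum_smul_le_of_gram hC S (fun i => ipp x (v i))
  rw [← hT] at hsyn
  set y := ∑ i ∈ S, ipp x (v i) • v i with hy
  have hin : ipp y x = (T : ℂ) := by
    rw [hy, hT, ipp, inner_sum, Complex.ofReal_sum]
    refine Finset.sum_congr rfl fun i _ => ?_
    rw [inner_smul_right, ipp, ← inner_conj_symm x, RCLike.mul_conj]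
    simp
  have hT0 : 0 ≤ T := Finset.sum_nonneg fun i _ => by positivity
  have hle : T ≤ ‖x‖ * ‖y‖ := by
    have h := norm_inner_le_norm (𝕜 := ℂ) x y
    change ‖ipp y x‖ ≤ _ at h
    rwa [hin, Complex.norm_real, Real.norm_of_nonneg hT0] at h
  rcases hT0.eq_or_lt with h0 | h0
  · rw [← h0]
    positivity
  · have h2 : T * T ≤ T * (C * ‖x‖ ^ 2) := by
      calc T * T ≤ (‖x‖ * ‖y‖) * (‖x‖ * ‖y‖) := mul_self_le_mul_self hT0 hle
        _ = ‖x‖ ^ 2 * ‖y‖ ^ 2 := by ring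
        _ ≤ ‖x‖ ^ 2 * (C * T) := by gcongr
        _ = T * (C * ‖x‖ ^ 2) := by ring
    exact le_of_mul_le_mul_left h2 h0

theorem hasSum_sum_finsum_of_finite {ι κ M : Type*} [Fintype κ] [AddCommMonoid M]
    [TopologicalSpace M] {f : ι × κ → M} (hf : ∀ k, {i | f (i, k) ≠ 0}.Finite) :
    HasSum f (∑ k, ∑ᶠ i, f (i, k)) := by
  classical
  let S : Finset ι := Finset.univ.biUnion fun k => (hf k).toFinset
  have hS : ∀ i k, f (i, k) ≠ 0 → i ∈ S := fun i k h => by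
    simp only [S, Finset.mem_biUnion, Finset.mem_univ, true_and, Set.Finite.mem_toFinset]
    exact ⟨k, h⟩
  have key : HasSum f (∑ p ∈ S ×ˢ Finset.univ, f p) := by
    refine hasSum_sum_of_ne_finset_zero fun p hp => ?_
    by_contra h
    exact hp (Finset.mem_product.2 ⟨hS p.1 p.2 h, Finset.mem_univ _⟩)
  rw [Finset.sum_product_right] at key
  convert key using 2 with k
  exact finsum_eq_sum_of_support_subset _ fun i hi => hS i k hi

theorem ipp_map_map {G H : Type*} [Group G] [NormedAddCommGroup H] [InnerProductSpace ℂ H]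
    (ν : G →* (H ≃ₗᵢ[ℂ] H)) (g g' : G) (x y : H) :
    ipp (ν g x) (ν g' y) = ipp x (ν (g⁻¹ * g') y) := by
  have h : ν g' y = ν g (ν (g⁻¹ * g') y) := by
    change _ = (ν g * ν (g⁻¹ * g')) y
    rw [← map_mul, mul_inv_cancel_left]
  rw [h, ipp, ipp, LinearIsometryEquiv.inner_map_map]

/-- The orbit of finitely many vectors with finitely supported mutual coefficients has a Gram
matrix with bounded row sums. -/
theorem exists_gram_bound {G H : Type*} [Group G] [NormedAddCommGroup H]
    [InnerProductSpace ℂ H] (ν : G →* (H ≃ₗᵢ[ℂ] H)) {d : ℕ} (ζs : Fin d → H)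
    (hfin : ∀ i j, {g : G | ipp (ζs i) (ν g (ζs j)) ≠ 0}.Finite) :
    ∃ C : ℝ, 0 < C ∧ ∀ (p : G × Fin d) (S : Finset (G × Fin d)),
      ∑ q ∈ S, ‖ipp (ν p.1 (ζs p.2)) (ν q.1 (ζs q.2))‖ ≤ C := by
  classical
  have hs : ∀ i, Summable fun q : G × Fin d => ‖ipp (ζs i) (ν q.1 (ζs q.2))‖ := fun i =>
    (hasSum_sum_finsum_of_finite fun j => by simpa using hfin i j).summable
  have hnn : ∀ i, 0 ≤ ∑' q : G × Fin d, ‖ipp (ζs i) (ν q.1 (ζs q.2))‖ := fun i =>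
    tsum_nonneg fun _ => norm_nonneg _
  refine ⟨∑ i, (∑' q : G × Fin d, ‖ipp (ζs i) (ν q.1 (ζs q.2))‖) + 1,
    add_pos_of_nonneg_of_pos (Finset.sum_nonneg fun i _ => hnn i) one_pos, fun p S => ?_⟩
  let e : G × Fin d ≃ G × Fin d := (Equiv.mulLeft p.1⁻¹).prodCongr (Equiv.refl _)
  calc ∑ q ∈ S, ‖ipp (ν p.1 (ζs p.2)) (ν q.1 (ζs q.2))‖
      = ∑ q ∈ S.map e.toEmbedding, ‖ipp (ζs p.2) (ν q.1 (ζs q.2))‖ := by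
        rw [Finset.sum_map]
        exact Finset.sum_congr rfl fun q _ => by rw [ipp_map_map]; rfl
    _ ≤ ∑' q : G × Fin d, ‖ipp (ζs p.2) (ν q.1 (ζs q.2))‖ :=
        (hs p.2).sum_le_tsum _ fun _ _ => norm_nonneg _
    _ ≤ ∑ i, ∑' q : G × Fin d, ‖ipp (ζs i) (ν q.1 (ζs q.2))‖ :=
        Finset.single_le_sum (f := fun i => ∑' q : G × Fin d, ‖ipp (ζs i) (ν q.1 (ζs q.2))‖)
          (fun i _ => hnn i) (Finset.mem_univ p.2)
    _ ≤ _ := le_add_of_nonneg_right zero_le_one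

/-- A reconstruction formula between two families with bounded Gram matrices extends to the
closure of the set on which it holds. -/
theorem hasSum_reconstruction_of_mem_closure {ι H : Type*} [NormedAddCommGroup H]
    [InnerProductSpace ℂ H] {v w : ι → H} {C D : ℝ} (hC0 : 0 < C) (hD0 : 0 < D)
    (hC : ∀ i (S : Finset ι), ∑ j ∈ S, ‖ipp (v i) (v j)‖ ≤ C)
    (hD : ∀ i (S : Finset ι), ∑ j ∈ S, ‖ipp (w i) (w j)‖ ≤ D) {E : Set H}
    (hE : ∀ x ∈ E, HasSum (fun i => ipp x (v i) • w i) x) {x : H} (hx : x ∈ closure E) :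
    HasSum (fun i => ipp x (v i) • w i) x := by
  let F : Finset ι → H → H := fun S x => ∑ i ∈ S, ipp x (v i) • w i
  have hbound : ∀ S x, ‖F S x‖ ≤ √(D * C) * ‖x‖ := fun S x => by
    refine le_of_sq_le_sq ?_ (by positivity)
    rw [mul_pow, Real.sq_sqrt (by positivity), mul_assoc]
    exact (norm_sq_sum_smul_le_of_gram hD S _).trans
      (mul_le_mul_of_nonneg_left (sum_norm_sq_ipp_le_of_gram hC0.le hC S x) hD0.le)
  have hsub : ∀ S x y, F S x - F S y = F S (x - y) := fun S x y => by
    simp only [F, ipp, inner_sub_right, sub_smul, Finset.sum_sub_distrib]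
  have hlip : ∀ S, LipschitzWith (√(D * C)).toNNReal (F S) := fun S =>
    LipschitzWith.of_dist_le' fun x y => by
      rw [dist_eq_norm, dist_eq_norm, hsub]
      exact hbound S (x - y)
  have hclosed : IsClosed {x | Filter.Tendsto (F · x) Filter.atTop (nhds (id x))} :=
    (LipschitzWith.uniformEquicontinuous F _ hlip).equicontinuous.isClosed_setOfPred_tendsto
      continuous_id
  exact closure_minimal (fun y hy => hE y hy) hclosed hx

/-- The reconstruction formula yields frame bounds. -/
theorem isGFrame_of_reconstruction {G H : Type*} [Group G] [NormedAddCommGroup H]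
    [InnerProductSpace ℂ H] (ν : G →* (H ≃ₗᵢ[ℂ] H)) {d : ℕ} {ζs ζt : Fin d → H} {K : Set H}
    (hmem : ∀ (g : G) (i : Fin d), (ν g (ζs i) : H) ∈ K) {C D : ℝ} (hC0 : 0 < C) (hD0 : 0 < D)
    (hC : ∀ (p : G × Fin d) (S : Finset (G × Fin d)),
      ∑ q ∈ S, ‖ipp (ν p.1 (ζs p.2)) (ν q.1 (ζs q.2))‖ ≤ C)
    (hD : ∀ (p : G × Fin d) (S : Finset (G × Fin d)),
      ∑ q ∈ S, ‖ipp (ν p.1 (ζt p.2)) (ν q.1 (ζt q.2))‖ ≤ D)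
    (hrec : ∀ ζ ∈ K,
      HasSum (fun p : G × Fin d => ipp ζ (ν p.1 (ζs p.2)) • (ν p.1 (ζt p.2) : H)) ζ) :
    IsGFrame ν ζs K := by
  refine ⟨hmem, D⁻¹, C, inv_pos.2 hD0, hC0, fun ζ hζ => ?_⟩
  have hbes := fun S => sum_norm_sq_ipp_le_of_gram
    (v := fun p : G × Fin d => ν p.1 (ζs p.2)) hC0.le hC S ζ
  have hsum : Summable fun p : G × Fin d => ‖ipp ζ (ν p.1 (ζs p.2))‖ ^ 2 :=
    summable_of_sum_le (fun _ => by positivity) hbes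
  have htsum : (∑' g : G, ∑ i, ‖ipp ζ (ν g (ζs i))‖ ^ 2)
      = ∑' p : G × Fin d, ‖ipp ζ (ν p.1 (ζs p.2))‖ ^ 2 := by
    rw [hsum.tsum_prod]
    simp only [tsum_fintype]
  rw [htsum]
  refine ⟨?_, hsum.tsum_le_of_sum_le hbes⟩
  rw [inv_mul_le_iff₀ hD0]
  refine le_of_tendsto ((hrec ζ hζ).norm.pow 2) (Filter.Eventually.of_forall fun S => ?_)
  exact (norm_sq_sum_smul_le_of_gram (v := fun p : G × Fin d => ν p.1 (ζt p.2)) hD S _).trans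
    (mul_le_mul_of_nonneg_left (hsum.sum_le_tsum S fun _ _ => by positivity) hD0.le)

theorem statement9
    {G H : Type*} [Group G] [Countable G] [DecidableEq G]
    [NormedAddCommGroup H] [InnerProductSpace ℂ H] [CompleteSpace H]
    (ν : G →* (H ≃ₗᵢ[ℂ] H))
    (Λ : Submodule ℂ H)
    (hΛinv : ∀ g : G, ∀ ζ ∈ Λ, ν g ζ ∈ Λ)
    (hΛfin : ∀ ζ ∈ Λ, ∀ η ∈ Λ, {g : G | ipp ζ (ν g η) ≠ 0}.Finite)
    (E : Submodule ℂ H) (hEΛ : E ≤ Λ)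
    (hEinv : ∀ g : G, ∀ ζ ∈ E, ν g ζ ∈ E)
    {d : ℕ} (ζs ζt : Fin d → H)
    (hζs : ∀ i, ζs i ∈ E) (hζt : ∀ i, ζt i ∈ E) :
    (DualGFrames ν ζs ζt (closure (E : Set H)) ∧
      ∀ (g g' : G) (i j : Fin d),
        ipp (ν g (ζs i) : H) (ν g' (ζt j) : H)
          = if g = g' ∧ i = j then 1 else 0)
    ↔
    ((∀ ζ ∈ E,
        (∑ i, ∑ᶠ g : G, ipp ζ (ν g (ζs i)) • (ν g (ζt i) : H)) = ζ ∧
        (∑ i, ∑ᶠ g : G, ipp ζ (ν g (ζt i)) • (ν g (ζs i) : H)) = ζ) ∧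
      ∀ (g : G) (i j : Fin d),
        ipp (ζs i) (ν g (ζt j) : H) = if g = 1 ∧ i = j then 1 else 0) := by
  have hcoef : ∀ ζ ∈ E, ∀ (us : Fin d → H), (∀ i, us i ∈ E) → ∀ i,
      {g : G | ipp ζ (ν g (us i)) ≠ 0}.Finite := fun ζ hζ us hus i =>
    hΛfin ζ (hEΛ hζ) (us i) (hEΛ (hus i))
  have hsumE : ∀ ζ ∈ E, ∀ (us ut : Fin d → H), (∀ i, us i ∈ E) →
      HasSum (fun p : G × Fin d => ipp ζ (ν p.1 (us p.2)) • (ν p.1 (ut p.2) : H))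
        (∑ i, ∑ᶠ g : G, ipp ζ (ν g (us i)) • (ν g (ut i) : H)) := fun ζ hζ us ut hus =>
    hasSum_sum_finsum_of_finite fun i => (hcoef ζ hζ us hus i).subset fun g hg h0 =>
      hg (by simp only [h0, zero_smul])
  constructor
  · rintro ⟨⟨-, -, hrec⟩, hbi⟩
    refine ⟨fun ζ hζ => ⟨?_, ?_⟩, fun g i j => ?_⟩
    · exact (hsumE ζ hζ ζs ζt hζs).unique (hrec ζ (subset_closure hζ)).1
    · exact (hsumE ζ hζ ζt ζs hζt).unique (hrec ζ (subset_closure hζ)).2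
    · simpa [eq_comm] using hbi 1 g i j
  · rintro ⟨hrec, hbi⟩
    obtain ⟨C, hC0, hC⟩ := exists_gram_bound ν ζs fun i j => hcoef _ (hζs i) ζs hζs j
    obtain ⟨D, hD0, hD⟩ := exists_gram_bound ν ζt fun i j => hcoef _ (hζt i) ζt hζt j
    have hst : ∀ ζ ∈ closure (E : Set H),
        HasSum (fun p : G × Fin d => ipp ζ (ν p.1 (ζs p.2)) • (ν p.1 (ζt p.2) : H)) ζ :=
      fun ζ hζ => hasSum_reconstruction_of_mem_closure hC0 hD0 hC hD (fun x hx => by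
        have h := hsumE x hx ζs ζt hζs
        rwa [(hrec x hx).1] at h) hζ
    have hts : ∀ ζ ∈ closure (E : Set H),
        HasSum (fun p : G × Fin d => ipp ζ (ν p.1 (ζt p.2)) • (ν p.1 (ζs p.2) : H)) ζ :=
      fun ζ hζ => hasSum_reconstruction_of_mem_closure hD0 hC0 hD hC (fun x hx => by
        have h := hsumE x hx ζt ζs hζt
        rwa [(hrec x hx).2] at h) hζ
    refine ⟨⟨?_, ?_, fun ζ hζ => ⟨hst ζ hζ, hts ζ hζ⟩⟩, fun g g' i j => ?_⟩
    · exact isGFrame_of_reconstruction ν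
        (fun g i => subset_closure (hEinv g _ (hζs i))) hC0 hD0 hC hD hst
    · exact isGFrame_of_reconstruction ν
        (fun g i => subset_closure (hEinv g _ (hζt i))) hD0 hC0 hD hC hts
    · rw [ipp_map_map, hbi]
      simp only [inv_mul_eq_one]

end
end

section
/- Let ζ₁, ζ₂ ∈ L²(ℝⁿ) be compactly supported. Then for almost every σ ∈ ℝⁿ the series Σ_{k∈ℤⁿ} ζ̂₁(σ+k) · conj(ζ̂₂(σ+k)) converges absolutely, and Σ_{g∈ℤⁿ} ⟨ζ₁, ν_g ζ₂⟩ e^{−2πi⟨g,σ⟩} = Σ_{k∈ℤⁿ} ζ̂₁(σ+k) · conj(ζ̂₂(σ+k)), where the sum on the left has only finitely many nonzero terms. -/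
/- STATEMENT 12: For compactly supported ζ₁, ζ₂ ∈ L²(ℝⁿ), for a.e. σ the series
Σ_{k∈ℤⁿ} ζ̂₁(σ+k) conj(ζ̂₂(σ+k)) converges absolutely and equals
Σ_{g∈ℤⁿ} ⟨ζ₁, ν_g ζ₂⟩ e^{−2πi⟨g,σ⟩}, the left sum having finitely many nonzero terms. -/

open MeasureTheory
open scoped ComplexConjugate Real

noncomputable section

/-- `L²(ℝⁿ)` with Lebesgue measure. -/
abbrev L2Rn (n : ℕ) : Type := Lp ℂ 2 (volume : Measure (Fin n → ℝ))

/-- An element of `L²(ℝⁿ)` is compactly supported if it vanishes a.e. outside a compact set. -/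
def CompSupp {n : ℕ} (ζ : L2Rn n) : Prop :=
  ∃ K : Set (Fin n → ℝ), IsCompact K ∧ ∀ᵐ x : Fin n → ℝ, x ∉ K → ζ x = 0

/-- The Fourier transform `ζ̂(y) = ∫ ζ(x) e^{−2πi⟨x,y⟩} dx`. -/
def fhat {n : ℕ} (ζ : L2Rn n) (y : Fin n → ℝ) : ℂ :=
  ∫ x : Fin n → ℝ,
    ζ x * Complex.exp (-(2 * (π : ℂ) * Complex.I) * ∑ i, (x i : ℂ) * (y i : ℂ))

/-- The character `e^{-2πi⟨x,y⟩}`. -/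
def fourierKernel {n : ℕ} (x y : Fin n → ℝ) : ℂ :=
  Complex.exp (-(2 * (π : ℂ) * Complex.I) * ∑ i, (x i : ℂ) * (y i : ℂ))

/-- The inclusion `ℤⁿ → ℝⁿ`. -/
def intVec {n : ℕ} (k : Fin n → ℤ) : Fin n → ℝ := fun i => (k i : ℝ)

/-- The half-open unit cube `(0,1]ⁿ`. -/
def unitCube (n : ℕ) : Set (Fin n → ℝ) := {x | ∀ i, x i ∈ Set.Ioc (0 : ℝ) 1}

section Kernel

variable {n : ℕ} (x y z : Fin n → ℝ)

lemma fourierKernel_add_left :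
    fourierKernel (x + y) z = fourierKernel x z * fourierKernel y z := by
  simp only [fourierKernel, ← Complex.exp_add, ← mul_add, ← Finset.sum_add_distrib, Pi.add_apply,
    Complex.ofReal_add, add_mul]

lemma fourierKernel_add_right :
    fourierKernel x (y + z) = fourierKernel x y * fourierKernel x z := by
  simp only [fourierKernel, ← Complex.exp_add, ← mul_add, ← Finset.sum_add_distrib, Pi.add_apply,
    Complex.ofReal_add]

lemma fourierKernel_eq_exp_ofReal_mul_I :
    fourierKernel x y = Complex.exp (((-(2 * π) * ∑ i, x i * y i : ℝ) : ℂ) * Complex.I) := by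
  rw [fourierKernel]
  congr 1
  push_cast
  ring

lemma norm_fourierKernel : ‖fourierKernel x y‖ = 1 := by
  rw [fourierKernel_eq_exp_ofReal_mul_I, Complex.norm_exp_ofReal_mul_I]

lemma fourierKernel_mul_conj : fourierKernel x y * conj (fourierKernel x y) = 1 := by
  rw [Complex.mul_conj, Complex.normSq_eq_norm_sq, norm_fourierKernel]
  simp

lemma fourierKernel_intVec_intVec (g k : Fin n → ℤ) :
    fourierKernel (intVec g) (intVec k) = 1 := by
  rw [fourierKernel, Complex.exp_eq_one_iff]
  refine ⟨-∑ i, g i * k i, ?_⟩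
  simp only [intVec]
  push_cast
  ring

lemma continuous_fourierKernel_left : Continuous fun x => fourierKernel x y := by
  unfold fourierKernel
  fun_prop

lemma mFourier_neg_coe (k : Fin n → ℤ) :
    UnitAddTorus.mFourier (-k) (fun i => (x i : UnitAddCircle)) = fourierKernel x (intVec k) := by
  simp only [UnitAddTorus.mFourier, ContinuousMap.coe_mk, fourier_coe_apply, fourierKernel,
    ← Complex.exp_sum, Finset.mul_sum, intVec, Pi.neg_apply]
  congr 1
  refine Finset.sum_congr rfl fun i _ => ?_
  push_cast
  ring

end Kernel

section Torus

local instance : MeasureSpace UnitAddCircle := ⟨AddCircle.haarAddCircle⟩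

variable {n : ℕ}

lemma unitCube_eq : unitCube n = {x : Fin n → ℝ | ∀ i, x i ∈
    Set.Ioc ((0 : Fin n → ℝ) i) ((0 : Fin n → ℝ) i + 1)} := by
  simp [unitCube]

lemma measurableSet_unitCube : MeasurableSet (unitCube n) :=
  MeasurableSet.univ_pi' fun _ => measurableSet_Ioc

/-- The section of `ℝⁿ → (ℝ/ℤ)ⁿ` with values in the unit cube. -/
def torusSection (t : UnitAddTorus (Fin n)) : Fin n → ℝ :=
  (UnitAddTorus.measurableEquivPiIoc (0 : Fin n → ℝ) t).1

lemma measurePreserving_torusSection :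
    MeasurePreserving (torusSection (n := n)) volume (volume.restrict (unitCube n)) := by
  have h := UnitAddTorus.measurePreserving_equivPiIoc (0 : Fin n → ℝ)
  have hQ : MeasurableSet {x : Fin n → ℝ | ∀ i, x i ∈
      Set.Ioc ((0 : Fin n → ℝ) i) ((0 : Fin n → ℝ) i + 1)} := by
    rw [← unitCube_eq]
    exact measurableSet_unitCube
  have h' := (MeasurePreserving.comp (measurePreserving_subtype_coe
    (μa := (volume : Measure (Fin n → ℝ))) hQ) h)
  rw [unitCube_eq]
  exact h'

lemma torusSection_coe {x : Fin n → ℝ} (hx : x ∈ unitCube n) :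
    torusSection (fun i => (x i : UnitAddCircle)) = x := by
  rw [unitCube_eq] at hx
  have := (UnitAddTorus.measurableEquivPiIoc (0 : Fin n → ℝ)).apply_symm_apply ⟨x, hx⟩
  exact congrArg Subtype.val this

lemma integral_torus_eq_setIntegral_unitCube (H : UnitAddTorus (Fin n) → ℂ) :
    ∫ t, H t = ∫ x in unitCube n, H (fun i => (x i : UnitAddCircle)) := by
  rw [unitCube_eq]
  exact UnitAddTorus.integral_preimage H 0

/-- Parseval's identity on the unit cube. -/
lemma hasSum_fourier_unitCube {F G : (Fin n → ℝ) → ℂ}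
    (hF : MemLp F 2 (volume.restrict (unitCube n)))
    (hG : MemLp G 2 (volume.restrict (unitCube n))) :
    HasSum (fun k : Fin n → ℤ =>
      (∫ x in unitCube n, F x * fourierKernel x (intVec k)) *
        conj (∫ x in unitCube n, G x * fourierKernel x (intVec k)))
      (∫ x in unitCube n, F x * conj (G x)) := by
  have hF' := hF.comp_measurePreserving measurePreserving_torusSection
  have hG' := hG.comp_measurePreserving measurePreserving_torusSection
  have coeff : ∀ {H : (Fin n → ℝ) → ℂ} (hH : MemLp (H ∘ torusSection) 2 volume) (k : Fin n → ℤ),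
      UnitAddTorus.mFourierCoeff (hH.toLp _) k
        = ∫ x in unitCube n, H x * fourierKernel x (intVec k) := by
    intro H hH k
    trans ∫ t, UnitAddTorus.mFourier (-k) t • (H ∘ torusSection) t
    · refine integral_congr_ae ?_
      filter_upwards [hH.coeFn_toLp] with t ht
      rw [ht]
    · rw [integral_torus_eq_setIntegral_unitCube]
      refine setIntegral_congr_fun measurableSet_unitCube fun x hx => ?_
      simp only [Function.comp_apply, torusSection_coe hx, mFourier_neg_coe, smul_eq_mul]
      ring
  have key := UnitAddTorus.hasSum_prod_mFourierCoeff (hG'.toLp _) (hF'.toLp _)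
  simp only [coeff] at key
  convert! key using 1
  · ext k
    ring
  · trans ∫ t, conj ((G ∘ torusSection) t) * (F ∘ torusSection) t
    · rw [integral_torus_eq_setIntegral_unitCube]
      refine setIntegral_congr_fun measurableSet_unitCube fun x hx => ?_
      simp only [Function.comp_apply, torusSection_coe hx]
      ring
    · refine integral_congr_ae ?_
      filter_upwards [hF'.coeFn_toLp, hG'.coeFn_toLp] with t h1 h2
      rw [h1, h2]

end Torus

section Tiling

variable {n : ℕ}

/-- The integral over `ℝⁿ` is the sum of the integrals over the integer translates of the cube. -/
lemma hasSum_setIntegral_unitCube {F : (Fin n → ℝ) → ℂ} (hF : Integrable F) :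
    HasSum (fun g : Fin n → ℤ => ∫ x in unitCube n, F (x + intVec g)) (∫ x, F x) := by
  have mem : ∀ (x : Fin n → ℝ) (g : Fin n → ℤ),
      x ∈ (fun x => x - intVec g) ⁻¹' unitCube n ↔ g = fun i => ⌈x i⌉ - 1 := by
    intro x g
    simp only [Set.mem_preimage, unitCube, Set.mem_ofPred_eq, Pi.sub_apply, intVec, Set.mem_Ioc,
      funext_iff]
    refine forall_congr' fun i => ?_
    rw [eq_sub_iff_add_eq, eq_comm, Int.ceil_eq_iff]
    push_cast
    constructor <;> rintro ⟨h1, h2⟩ <;> constructor <;> linarith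
  have hU : ⋃ g : Fin n → ℤ, (fun x => x - intVec g) ⁻¹' unitCube n = Set.univ :=
    Set.eq_univ_of_forall fun x => Set.mem_iUnion.2 ⟨_, (mem x _).2 rfl⟩
  have h := hasSum_integral_iUnion (μ := volume) (f := F)
    (s := fun g : Fin n → ℤ => (fun x => x - intVec g) ⁻¹' unitCube n)
    (fun g => (measurable_id.sub_const (intVec g)) measurableSet_unitCube)
    (fun g g' hne => Set.disjoint_left.2 fun x hx hx' =>
      hne (((mem x g).1 hx).trans ((mem x g').1 hx').symm)) hF.integrableOn
  rw [hU, setIntegral_univ] at h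
  convert! h using 2 with g
  rw [← (measurePreserving_sub_right volume (intVec g)).setIntegral_preimage_emb
    (measurableEmbedding_subRight _) (fun x => F (x + intVec g))]
  simp

variable {f f₁ f₂ : (Fin n → ℝ) → ℂ} {S : Finset (Fin n → ℤ)}

lemma integral_eq_sum_unitCube (hf : Integrable f)
    (hS : ∀ x ∈ unitCube n, ∀ g ∉ S, f (x + intVec g) = 0) :
    ∫ x, f x = ∑ g ∈ S, ∫ x in unitCube n, f (x + intVec g) := by
  rw [← (hasSum_setIntegral_unitCube hf).tsum_eq, tsum_eq_sum fun g hg => ?_]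
  exact setIntegral_eq_zero_of_forall_eq_zero fun x hx => hS x hx g hg

lemma MeasureTheory.MemLp.comp_add_const {p : ENNReal} (hf : MemLp f p) (v : Fin n → ℝ) :
    MemLp (fun x => f (x + v)) p :=
  hf.comp_measurePreserving (measurePreserving_add_right volume v)

lemma integrable_mul_conj_comp_add (h₁ : MemLp f₁ 2) (h₂ : MemLp f₂ 2) (v w : Fin n → ℝ) :
    Integrable fun x => f₁ (x + v) * conj (f₂ (x + w)) :=
  (h₁.comp_add_const v).integrable_mul (h₂.comp_add_const w).star

open scoped Pointwise in
lemma mul_conj_sub_eq_zero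
    (hS₁ : ∀ x ∈ unitCube n, ∀ g ∉ S, f₁ (x + intVec g) = 0)
    (hS₂ : ∀ x ∈ unitCube n, ∀ g ∉ S, f₂ (x + intVec g) = 0)
    {d : Fin n → ℤ} (hd : d ∉ S - S) {x : Fin n → ℝ} (hx : x ∈ unitCube n) (g : Fin n → ℤ) :
    f₁ (x + intVec g) * conj (f₂ (x + intVec (g - d))) = 0 := by
  by_cases hg : g ∈ S
  · rw [hS₂ x hx (g - d) fun h => hd (Finset.mem_sub.2 ⟨g, hg, g - d, h, by abel⟩)]
    simp
  · rw [hS₁ x hx g hg, zero_mul]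

lemma add_intVec_sub (x : Fin n → ℝ) (g d : Fin n → ℤ) :
    x + intVec g - intVec d = x + intVec (g - d) := by
  ext i
  simp [intVec, add_sub_assoc]

open scoped Pointwise in
lemma integral_mul_conj_sub_eq_zero (h₁ : MemLp f₁ 2) (h₂ : MemLp f₂ 2)
    (hS₁ : ∀ x ∈ unitCube n, ∀ g ∉ S, f₁ (x + intVec g) = 0)
    (hS₂ : ∀ x ∈ unitCube n, ∀ g ∉ S, f₂ (x + intVec g) = 0)
    {d : Fin n → ℤ} (hd : d ∉ S - S) :
    ∫ x, f₁ x * conj (f₂ (x - intVec d)) = 0 := by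
  have hi : Integrable fun x => f₁ x * conj (f₂ (x - intVec d)) := by
    simpa [sub_eq_add_neg] using integrable_mul_conj_comp_add h₁ h₂ 0 (-intVec d)
  rw [← (hasSum_setIntegral_unitCube hi).tsum_eq]
  simp only [add_intVec_sub]
  refine (tsum_congr fun g => ?_).trans tsum_zero
  exact setIntegral_eq_zero_of_forall_eq_zero fun x hx => mul_conj_sub_eq_zero hS₁ hS₂ hd hx g

open scoped Pointwise in
/-- The inner product over the cube of two periodizations. -/
lemma setIntegral_periodization_mul_conj (h₁ : MemLp f₁ 2) (h₂ : MemLp f₂ 2)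
    (hS₁ : ∀ x ∈ unitCube n, ∀ g ∉ S, f₁ (x + intVec g) = 0)
    (hS₂ : ∀ x ∈ unitCube n, ∀ g ∉ S, f₂ (x + intVec g) = 0) :
    ∫ x in unitCube n, (∑ g ∈ S, f₁ (x + intVec g)) * conj (∑ g ∈ S, f₂ (x + intVec g))
      = ∑ d ∈ S - S, ∫ x, f₁ x * conj (f₂ (x - intVec d)) := by
  have hR : ∀ d, ∫ x, f₁ x * conj (f₂ (x - intVec d)) = ∑ g ∈ S, ∫ x in unitCube n,
      f₁ (x + intVec g) * conj (f₂ (x + intVec (g - d))) := by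
    intro d
    have hi : Integrable fun x => f₁ x * conj (f₂ (x - intVec d)) := by
      simpa [sub_eq_add_neg] using integrable_mul_conj_comp_add h₁ h₂ 0 (-intVec d)
    rw [integral_eq_sum_unitCube (S := S) hi fun x hx g hg => by rw [hS₁ x hx g hg, zero_mul]]
    simp only [add_intVec_sub]
  simp only [hR, map_sum, Finset.sum_mul_sum]
  rw [Finset.sum_comm, integral_finsetSum _ fun g _ => integrable_finsetSum _ fun h _ =>
    (integrable_mul_conj_comp_add h₁ h₂ _ _).integrableOn]
  refine Finset.sum_congr rfl fun g hg => ?_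
  rw [integral_finsetSum _ fun h _ => (integrable_mul_conj_comp_add h₁ h₂ _ _).integrableOn]
  set u : (Fin n → ℤ) → ℂ := fun h =>
    ∫ x in unitCube n, f₁ (x + intVec g) * conj (f₂ (x + intVec h)) with hu
  have e1 : ∑' h, u h = ∑ h ∈ S, u h := tsum_eq_sum fun h hh =>
    setIntegral_eq_zero_of_forall_eq_zero fun x hx => by rw [hS₂ x hx h hh, map_zero, mul_zero]
  have e2 : ∑' d, u (g - d) = ∑ d ∈ S - S, u (g - d) := tsum_eq_sum fun d hd =>
    setIntegral_eq_zero_of_forall_eq_zero fun x hx => mul_conj_sub_eq_zero hS₁ hS₂ hd hx g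
  exact e1.symm.trans (((Equiv.subLeft g).tsum_eq u).symm.trans e2)

open scoped Pointwise in
/-- Poisson-type summation: the Fourier coefficients at integer points of two square-integrable
functions supported in finitely many cubes. -/
lemma hasSum_fourier_mul_conj (h₁ : MemLp f₁ 2) (h₂ : MemLp f₂ 2)
    (i₁ : Integrable f₁) (i₂ : Integrable f₂)
    (hS₁ : ∀ x ∈ unitCube n, ∀ g ∉ S, f₁ (x + intVec g) = 0)
    (hS₂ : ∀ x ∈ unitCube n, ∀ g ∉ S, f₂ (x + intVec g) = 0) :
    HasSum (fun k : Fin n → ℤ => (∫ x, f₁ x * fourierKernel x (intVec k)) *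
        conj (∫ x, f₂ x * fourierKernel x (intVec k)))
      (∑ d ∈ S - S, ∫ x, f₁ x * conj (f₂ (x - intVec d))) := by
  have mem : ∀ {f : (Fin n → ℝ) → ℂ}, MemLp f 2 →
      MemLp (fun x => ∑ g ∈ S, f (x + intVec g)) 2 (volume.restrict (unitCube n)) :=
    fun hf => (memLp_finsetSum _ fun g _ => hf.comp_add_const _).restrict _
  have int_mul : ∀ {f : (Fin n → ℝ) → ℂ}, Integrable f → ∀ k : Fin n → ℤ,
      Integrable fun x => f x * fourierKernel x (intVec k) := fun hf k =>
    hf.mul_bdd (c := 1) (continuous_fourierKernel_left _).aestronglyMeasurable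
      (.of_forall fun x => (norm_fourierKernel _ _).le)
  have coeff : ∀ {f : (Fin n → ℝ) → ℂ}, Integrable f →
      (∀ x ∈ unitCube n, ∀ g ∉ S, f (x + intVec g) = 0) → ∀ k : Fin n → ℤ,
      ∫ x in unitCube n, (∑ g ∈ S, f (x + intVec g)) * fourierKernel x (intVec k)
        = ∫ x, f x * fourierKernel x (intVec k) := by
    intro f hf hS k
    rw [integral_eq_sum_unitCube (S := S) (int_mul hf k)
      fun x hx g hg => by rw [hS x hx g hg, zero_mul]]
    simp only [fourierKernel_add_left, fourierKernel_intVec_intVec, mul_one, Finset.sum_mul]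
    exact integral_finsetSum _ fun g _ => (int_mul (hf.comp_add_right _) k).integrableOn
  have key := hasSum_fourier_unitCube (mem h₁) (mem h₂)
  rw [setIntegral_periodization_mul_conj h₁ h₂ hS₁ hS₂] at key
  simpa only [coeff i₁ hS₁, coeff i₂ hS₂] using key

lemma exists_finset_cover {K : Set (Fin n → ℝ)} (hK : Bornology.IsBounded K) :
    ∃ S : Finset (Fin n → ℤ), ∀ x ∈ unitCube n, ∀ g ∉ S, x + intVec g ∉ K := by
  obtain ⟨R, hR⟩ := hK.subset_closedBall 0
  refine ⟨Fintype.piFinset fun _ => Finset.Icc (-(⌈R⌉ + 1)) (⌈R⌉ + 1),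
    fun x hx g hg hK' => hg (Fintype.mem_piFinset.2 fun i => ?_)⟩
  have h1 : |x i + g i| ≤ R := by
    have := (norm_le_pi_norm (x + intVec g) i).trans (mem_closedBall_zero_iff.1 (hR hK'))
    simpa [intVec] using this
  obtain ⟨h2, h3⟩ := abs_le.1 h1
  obtain ⟨h4, h5⟩ := hx i
  have h6 := Int.le_ceil R
  rw [Finset.mem_Icc]
  constructor
  · have : ((-(⌈R⌉ + 1) : ℤ) : ℝ) ≤ g i := by push_cast; linarith
    exact_mod_cast this
  · have : (g i : ℝ) ≤ ((⌈R⌉ + 1 : ℤ) : ℝ) := by push_cast; linarith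
    exact_mod_cast this

end Tiling

/-- A compactly supported element of `L²(ℝⁿ)` has a representative vanishing identically off a
compact set. -/
lemma CompSupp.exists_representative {n : ℕ} {ζ : L2Rn n} (h : CompSupp ζ) :
    ∃ (K : Set (Fin n → ℝ)) (f : (Fin n → ℝ) → ℂ), IsCompact K ∧ ζ =ᵐ[volume] f ∧
      MemLp f 2 ∧ Integrable f ∧ ∀ x ∉ K, f x = 0 := by
  obtain ⟨K, hK, hz⟩ := h
  have hae : ζ =ᵐ[volume] K.indicator ζ := by
    filter_upwards [hz] with x hx
    by_cases hxK : x ∈ K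
    · rw [Set.indicator_of_mem hxK]
    · rw [Set.indicator_of_notMem hxK, hx hxK]
  refine ⟨K, K.indicator ζ, hK, hae, (Lp.memLp ζ).ae_eq hae, ?_,
    fun x hx => Set.indicator_of_notMem hx _⟩
  rw [integrable_indicator_iff hK.measurableSet]
  have : IsFiniteMeasure (volume.restrict K) := ⟨by simpa using hK.measure_lt_top⟩
  exact ((Lp.memLp ζ).restrict K).integrable (by norm_num)

theorem statement12
    (n : ℕ)
    (ν : (Fin n → ℤ) → (L2Rn n ≃ₗᵢ[ℂ] L2Rn n))
    (hν : ∀ (g : Fin n → ℤ) (ζ : L2Rn n),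
      ∀ᵐ x : Fin n → ℝ, (ν g ζ : L2Rn n) x = ζ (x - fun i => (g i : ℝ)))
    (ζ₁ ζ₂ : L2Rn n) (h₁ : CompSupp ζ₁) (h₂ : CompSupp ζ₂) :
    {g : Fin n → ℤ | ipp ζ₁ (ν g ζ₂) ≠ 0}.Finite ∧
    ∀ᵐ σ : Fin n → ℝ,
      Summable (fun k : Fin n → ℤ =>
        ‖fhat ζ₁ (σ + fun i => (k i : ℝ)) * conj (fhat ζ₂ (σ + fun i => (k i : ℝ)))‖) ∧
      (∑ᶠ g : Fin n → ℤ,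
          ipp ζ₁ (ν g ζ₂) * Complex.exp (-(2 * (π : ℂ) * Complex.I) * ∑ i, (g i : ℂ) * (σ i : ℂ)))
        = ∑' k : Fin n → ℤ,
            fhat ζ₁ (σ + fun i => (k i : ℝ)) * conj (fhat ζ₂ (σ + fun i => (k i : ℝ))) := by
  open scoped Pointwise in
  obtain ⟨K₁, f₁, hK₁, ae₁, m₁, i₁, z₁⟩ := h₁.exists_representative
  obtain ⟨K₂, f₂, hK₂, ae₂, m₂, i₂, z₂⟩ := h₂.exists_representative
  obtain ⟨S, hS⟩ := exists_finset_cover (hK₁.union hK₂).isBounded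
  have hS₁ : ∀ x ∈ unitCube n, ∀ g ∉ S, f₁ (x + intVec g) = 0 :=
    fun x hx g hg => z₁ _ fun h => hS x hx g hg (Or.inl h)
  have hS₂ : ∀ x ∈ unitCube n, ∀ g ∉ S, f₂ (x + intVec g) = 0 :=
    fun x hx g hg => z₂ _ fun h => hS x hx g hg (Or.inr h)
  have hipp : ∀ g, ipp ζ₁ (ν g ζ₂) = ∫ x, f₁ x * conj (f₂ (x - intVec g)) := by
    intro g
    rw [ipp, L2.inner_def]
    refine integral_congr_ae ?_
    filter_upwards [hν g ζ₂, ae₁, (measurePreserving_sub_right volume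
      (intVec g)).quasiMeasurePreserving.ae ae₂] with x hx hx₁ hx₂
    rw [hx, hx₁, RCLike.inner_apply, ← hx₂]
    rfl
  have hzero : ∀ g ∉ S - S, ipp ζ₁ (ν g ζ₂) = 0 := fun g hg =>
    (hipp g).trans (integral_mul_conj_sub_eq_zero m₁ m₂ hS₁ hS₂ hg)
  refine ⟨(S - S).finite_toSet.subset fun g hg => by_contra fun h => hg (hzero g h),
    .of_forall fun σ => ?_⟩
  have mod_int : ∀ {f : (Fin n → ℝ) → ℂ}, Integrable f →
      Integrable fun x => f x * fourierKernel x σ := fun hf =>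
    hf.mul_bdd (c := 1) (continuous_fourierKernel_left _).aestronglyMeasurable
      (.of_forall fun x => (norm_fourierKernel _ _).le)
  have mod_mem : ∀ {f : (Fin n → ℝ) → ℂ}, MemLp f 2 →
      MemLp (fun x => f x * fourierKernel x σ) 2 := fun {f} hf =>
    hf.of_le (hf.1.mul (continuous_fourierKernel_left _).aestronglyMeasurable)
      (.of_forall fun x => by rw [norm_mul, norm_fourierKernel, mul_one])
  have hfhat : ∀ {ζ : L2Rn n} {f : (Fin n → ℝ) → ℂ}, ζ =ᵐ[volume] f → ∀ k : Fin n → ℤ,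
      ∫ x, f x * fourierKernel x σ * fourierKernel x (intVec k)
        = fhat ζ (σ + fun i => (k i : ℝ)) := by
    intro ζ f hae k
    refine integral_congr_ae ?_
    filter_upwards [hae] with x hx
    rw [hx, mul_assoc, ← fourierKernel_add_right]
    rfl
  have key := hasSum_fourier_mul_conj (mod_mem m₁) (mod_mem m₂) (mod_int i₁) (mod_int i₂)
    (fun x hx g hg => by rw [hS₁ x hx g hg, zero_mul])
    (fun x hx g hg => by rw [hS₂ x hx g hg, zero_mul])
  simp only [hfhat ae₁, hfhat ae₂] at key
  refine ⟨key.summable.norm, ?_⟩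
  rw [key.tsum_eq, finsum_eq_sum_of_support_subset (s := S - S)]
  · refine Finset.sum_congr rfl fun g _ => ?_
    rw [hipp g, ← integral_mul_const]
    refine integral_congr_ae (.of_forall fun x => ?_)
    have hx : fourierKernel x σ
        = fourierKernel (x - intVec g) σ * fourierKernel (intVec g) σ := by
      rw [← fourierKernel_add_left, sub_add_cancel]
    have hg : Complex.exp (-(2 * (π : ℂ) * Complex.I) * ∑ i, (g i : ℂ) * (σ i : ℂ))
        = fourierKernel (intVec g) σ := by
      simp [fourierKernel, intVec]
    simp only [hg, map_mul]
    rw [hx]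
    linear_combination (-(f₁ x * conj (f₂ (x - intVec g)) * fourierKernel (intVec g) σ)) *
      fourierKernel_mul_conj (x - intVec g) σ
  · intro g hg
    by_contra h
    exact hg (by simp only [hzero g h, zero_mul])

end
end
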